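/- arXiv:1210.7099 — 2 statements merged into one kernel-verified Lean document; each statement's English description precedes it below -/
import Mathlib

section
/- Let B₀ : X × Y → Z be a norming bilinear map, i.e., a continuous bilinear map with B₀(U_X × U_Y) = U_Z. Then the following are equivalent: (1) Z has the Daugavet property; (2) ‖B₀ + T ∘ B₀‖ = 1 + ‖T ∘ B₀‖ for every rank-one operator T : Z → Z; (3) the same for every compact T; (4) the same for every weakly compact T. -/
/-- A Banach space has the Daugavet property if `‖Id + K‖ = 1 + ‖K‖` for every
rank-one operator `K = z' ⊗ z`. -/
def DaugavetProperty (Z : Type*) [NormedAddCommGroup Z] [NormedSpace ℝ Z] : Prop :=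
  ∀ (z' : Z →L[ℝ] ℝ) (z : Z),
    ‖ContinuousLinearMap.id ℝ Z + z'.smulRight z‖ = 1 + ‖z'.smulRight z‖

/-- An operator is weakly compact if the image of the closed unit ball is
relatively compact in the weak topology. -/
def WeaklyCompactOperator {Z : Type*} [NormedAddCommGroup Z] [NormedSpace ℝ Z]
    (T : Z →L[ℝ] Z) : Prop :=
  IsCompact (closure ((⇑T '' {z | ‖z‖ ≤ 1}) : Set (WeakSpace ℝ Z)))

variable {X Y Z : Type*} [NormedAddCommGroup X] [NormedSpace ℝ X]
  [NormedAddCommGroup Y] [NormedSpace ℝ Y]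
  [NormedAddCommGroup Z] [NormedSpace ℝ Z]

/-- The composition `T ∘ B` of an operator with a bilinear map, as a bilinear
map. -/
noncomputable def compBil (T : Z →L[ℝ] Z) (B : X →L[ℝ] Y →L[ℝ] Z) :
    X →L[ℝ] Y →L[ℝ] Z :=
  (ContinuousLinearMap.compL ℝ Y Z Z T).comp B

/-- A slice of the closed unit ball. -/
def IsSliceSet (S : Set Z) : Prop :=
  ∃ (g : Z →L[ℝ] ℝ) (c : ℝ), ‖g‖ = 1 ∧ c < 1 ∧ S = {x | ‖x‖ ≤ 1 ∧ c < g x}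

theorem IsSliceSet.of_lt (g : Z →L[ℝ] ℝ) (c : ℝ) (hg : 0 < ‖g‖) (hc : c < ‖g‖) :
    IsSliceSet {x : Z | ‖x‖ ≤ 1 ∧ c < g x} := by
  refine ⟨‖g‖⁻¹ • g, ‖g‖⁻¹ * c, ?_, ?_, ?_⟩
  · rw [norm_smul, norm_inv, norm_norm, inv_mul_cancel₀ hg.ne']
  · rw [inv_mul_lt_iff₀ hg]; simpa using hc
  · ext x
    simp [hg]

theorem IsSliceSet.nonempty {S : Set Z} (h : IsSliceSet S) : S.Nonempty := by
  obtain ⟨g, c, hg, hc, rfl⟩ := h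
  obtain ⟨x, hx, hgx⟩ := g.exists_lt_apply_of_lt_opNorm (r := c) (by rw [hg]; exact hc)
  rw [Real.norm_eq_abs] at hgx
  rcases abs_cases (g x) with ⟨h, _⟩ | ⟨h, _⟩
  · exact ⟨x, hx.le, by linarith⟩
  · exact ⟨-x, by rw [norm_neg]; exact hx.le, by rw [map_neg]; linarith⟩

theorem IsSliceSet.convex {S : Set Z} (h : IsSliceSet S) : Convex ℝ S := by
  obtain ⟨g, c, hg, hc, rfl⟩ := h
  have h1 : Convex ℝ {x : Z | ‖x‖ ≤ 1} := by
    have := convex_closedBall (0 : Z) 1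
    convert this using 1
    ext x; simp
  exact h1.inter (convex_halfSpace_gt (f := g) g.isLinear c)

theorem IsSliceSet.norm_le {S : Set Z} (h : IsSliceSet S) {x : Z} (hx : x ∈ S) : ‖x‖ ≤ 1 := by
  obtain ⟨g, c, hg, hc, rfl⟩ := h
  exact hx.1

theorem le_norm_of_functional (h : Z →L[ℝ] ℝ) (hh : ‖h‖ ≤ 1) (x : Z) : h x ≤ ‖x‖ := by
  have := h.le_opNorm x
  have h2 := le_abs_self (h x)
  rw [Real.norm_eq_abs] at this
  nlinarith [norm_nonneg x]

theorem daugavet_subslice_one (hD : DaugavetProperty Z) {S : Set Z} (hS : IsSliceSet S)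
    (y : Z) {ε : ℝ} (hε : 0 < ε) :
    ∃ S', IsSliceSet S' ∧ S' ⊆ S ∧ ∀ x ∈ S', 1 + ‖y‖ - ε ≤ ‖x + y‖ := by
  obtain ⟨g, c, hg, hc, rfl⟩ := hS
  by_cases hy : y = 0
  · subst hy
    refine ⟨_, ⟨g, max c (1 - ε), hg, max_lt hc (by linarith), rfl⟩, ?_, ?_⟩
    · rintro x ⟨h1, h2⟩
      exact ⟨h1, (le_max_left _ _).trans_lt h2⟩
    · rintro x ⟨h1, h2⟩
      have := le_norm_of_functional g hg.le x
      have := (le_max_right c (1 - ε)).trans_lt h2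
      simp
      linarith
  have hy0 : 0 < ‖y‖ := norm_pos_iff.mpr hy
  obtain ⟨η, hη0, hη1, hη2, hη3⟩ : ∃ η : ℝ, 0 < η ∧ η < ‖y‖ ∧ η ≤ (1 - c) * ‖y‖ ∧ η ≤ ε := by
    have h1 : 0 < (1 - c) * ‖y‖ := mul_pos (by linarith) hy0
    refine ⟨min (‖y‖ / 2) (min ((1 - c) * ‖y‖) ε), ?_, ?_, ?_, ?_⟩
    · positivity
    · exact (min_le_left _ _).trans_lt (by linarith)
    · exact (min_le_right _ _).trans (min_le_left _ _)
    · exact (min_le_right _ _).trans (min_le_right _ _)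
  have hN := hD g y
  rw [ContinuousLinearMap.norm_smulRight_apply, hg, one_mul] at hN
  obtain ⟨x₀, hx₀, hx₀'⟩ := ContinuousLinearMap.exists_lt_apply_of_lt_opNorm
    (ContinuousLinearMap.id ℝ Z + g.smulRight y) (r := 1 + ‖y‖ - η) (by rw [hN]; linarith)
  obtain ⟨h₀, hh₀, hh₀'⟩ := exists_dual_vector'' ℝ
    ((ContinuousLinearMap.id ℝ Z + g.smulRight y) x₀)
  have key : ∃ h : Z →L[ℝ] ℝ, ‖h‖ ≤ 1 ∧ 0 ≤ h y ∧ 1 + ‖y‖ - η < ‖h + h y • g‖ := by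
    have h1 : 1 + ‖y‖ - η < ‖h₀ + h₀ y • g‖ := by
      have e : (h₀ + h₀ y • g) x₀ = ‖(ContinuousLinearMap.id ℝ Z + g.smulRight y) x₀‖ := by
        have : (h₀ + h₀ y • g) x₀ = h₀ ((ContinuousLinearMap.id ℝ Z + g.smulRight y) x₀) := by
          simp [mul_comm]
        rw [this, hh₀']; rfl
      have h2 := (h₀ + h₀ y • g).le_opNorm x₀
      rw [e, norm_norm] at h2
      nlinarith [norm_nonneg (h₀ + h₀ y • g)]
    rcases le_total 0 (h₀ y) with h | h
    · exact ⟨h₀, hh₀, h, h1⟩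
    · refine ⟨-h₀, by rwa [norm_neg], by simpa using h, ?_⟩
      have : -h₀ + (-h₀) y • g = -(h₀ + h₀ y • g) := by
        ext; simp; ring
      rwa [this, norm_neg]
  obtain ⟨h, hh, hhy, hφ⟩ := key
  refine ⟨_, IsSliceSet.of_lt (h + h y • g) (1 + ‖y‖ - η) (by linarith) hφ, ?_, ?_⟩
  · rintro x ⟨hx, hx'⟩
    refine ⟨hx, ?_⟩
    simp only [add_apply, smul_apply, smul_eq_mul] at hx'
    have a1 := le_norm_of_functional h hh x
    have a2 := le_norm_of_functional h hh y
    have a3 : ‖y‖ - η < h y * g x := by linarith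
    have a4 : 0 < g x := by
      by_contra hn
      push Not at hn
      nlinarith
    have a5 : h y * g x ≤ ‖y‖ * g x := by gcongr
    have a6 : ‖y‖ * c < ‖y‖ * g x := by nlinarith
    exact lt_of_mul_lt_mul_left a6 hy0.le
  · rintro x ⟨hx, hx'⟩
    simp only [add_apply, smul_apply, smul_eq_mul] at hx'
    have a1 := le_norm_of_functional g hg.le x
    have a2 := le_norm_of_functional h hh (x + y)
    rw [map_add] at a2
    nlinarith

theorem daugavet_subslice_finite (hD : DaugavetProperty Z) {ε : ℝ} (hε : 0 < ε)
    {t : Set Z} (ht : t.Finite) {S : Set Z} (hS : IsSliceSet S) :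
    ∃ S', IsSliceSet S' ∧ S' ⊆ S ∧ ∀ x ∈ S', ∀ y ∈ t, 1 + ‖y‖ - ε ≤ ‖x + y‖ := by
  induction t, ht using Set.Finite.induction_on with
  | empty => exact ⟨S, hS, subset_rfl, by simp⟩
  | @insert a s _ _ ih =>
    obtain ⟨S₁, h1, h2, h3⟩ := ih
    obtain ⟨S₂, k1, k2, k3⟩ := daugavet_subslice_one hD h1 a hε
    refine ⟨S₂, k1, k2.trans h2, ?_⟩
    rintro x hx y (rfl | hy)
    · exact k3 x hx
    · exact h3 x (k2 hx) y hy

theorem daugavet_subslice_compact (hD : DaugavetProperty Z) {ε : ℝ} (hε : 0 < ε)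
    {K : Set Z} (hK : IsCompact K) {S : Set Z} (hS : IsSliceSet S) :
    ∃ S', IsSliceSet S' ∧ S' ⊆ S ∧ ∀ x ∈ S', ∀ y ∈ K, 1 + ‖y‖ - ε ≤ ‖x + y‖ := by
  obtain ⟨t, -, htf, ht⟩ := Metric.finite_approx_of_totallyBounded hK.totallyBounded
    (ε / 3) (by positivity)
  obtain ⟨S', h1, h2, h3⟩ := daugavet_subslice_finite hD (ε := ε / 3) (by positivity) htf hS
  refine ⟨S', h1, h2, fun x hx y hy => ?_⟩
  obtain ⟨z, hz, hyz⟩ := Set.mem_iUnion₂.mp (ht hy)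
  rw [Metric.mem_ball, dist_eq_norm] at hyz
  have a1 := h3 x hx z hz
  have a2 : ‖x + z‖ ≤ ‖x + y‖ + ‖y - z‖ := by
    have : x + z = (x + y) - (y - z) := by abel
    rw [this]; exact norm_sub_le _ _
  have a3 : ‖y‖ ≤ ‖z‖ + ‖y - z‖ := by
    have : y = z + (y - z) := by abel
    calc ‖y‖ = ‖z + (y - z)‖ := by rw [← this]
      _ ≤ _ := norm_add_le _ _
  linarith

theorem daugavet_weaklyCompact_aux (hD : DaugavetProperty Z) (T : Z →L[ℝ] Z)
    (hT : WeaklyCompactOperator T) (hT0 : 0 < ‖T‖) {ε : ℝ} (hε : 0 < ε) (hε' : ε < ‖T‖) :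
    ∃ x : Z, ‖x‖ ≤ 1 ∧ 1 + ‖T‖ - 6 * ε ≤ ‖x + T x‖ := by
  -- the initial slice
  obtain ⟨x₀, hx₀, hx₀'⟩ := T.exists_lt_apply_of_lt_opNorm (r := ‖T‖ - ε) (by linarith)
  obtain ⟨f, hf, hf'⟩ := exists_dual_vector'' ℝ (T x₀)
  have hfT : ‖T‖ - ε < ‖f.comp T‖ := by
    have h1 := (f.comp T).le_opNorm x₀
    rw [ContinuousLinearMap.comp_apply, hf'] at h1
    simp only [RCLike.ofReal_real_eq_id, id_eq, norm_norm] at h1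
    nlinarith [norm_nonneg (f.comp T)]
  have hS0 : IsSliceSet {x : Z | ‖x‖ ≤ 1 ∧ ‖T‖ - ε < (f.comp T) x} :=
    IsSliceSet.of_lt _ _ (by linarith) hfT
  have hS0n : ∀ x ∈ {x : Z | ‖x‖ ≤ 1 ∧ ‖T‖ - ε < (f.comp T) x}, ‖T‖ - ε ≤ ‖T x‖ := by
    rintro x ⟨_, hx⟩
    have := le_norm_of_functional f hf (T x)
    rw [ContinuousLinearMap.comp_apply] at hx
    linarith
  generalize {x : Z | ‖x‖ ≤ 1 ∧ ‖T‖ - ε < (f.comp T) x} = S₀ at hS0 hS0n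
  -- the step
  let State := {p : Set Z × Set Z // IsSliceSet p.1 ∧ p.2.Finite}
  have step : ∀ p : State, ∃ q : State, q.1.1 ⊆ p.1.1 ∧
      (∃ x ∈ p.1.1, q.1.2 = insert (T x) p.1.2) ∧
      ∀ x ∈ q.1.1, ∀ y ∈ convexHull ℝ q.1.2, 1 + ‖y‖ - ε ≤ ‖x + y‖ := by
    rintro ⟨⟨S, F⟩, hS, hF⟩
    obtain ⟨x, hx⟩ := hS.nonempty
    have hF' : (insert (T x) F).Finite := hF.insert _
    obtain ⟨S', h1, h2, h3⟩ := daugavet_subslice_compact hD hε (hF'.isCompact_convexHull ℝ) hS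
    exact ⟨⟨⟨S', insert (T x) F⟩, h1, hF'⟩, h2, ⟨x, hx, rfl⟩, h3⟩
  choose nxt hn1 hn2 hn3 using step
  let st : ℕ → State := fun n => Nat.rec ⟨⟨S₀, ∅⟩, hS0, Set.finite_empty⟩ (fun _ p => nxt p) n
  have hst : ∀ n, st (n + 1) = nxt (st n) := fun n => rfl
  let S : ℕ → Set Z := fun n => (st n).1.1
  let F : ℕ → Set Z := fun n => (st n).1.2
  have hSs : ∀ n, IsSliceSet (S n) := fun n => (st n).2.1
  have hSanti : Antitone S := antitone_nat_of_succ_le fun n => by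
    change (st (n + 1)).1.1 ⊆ (st n).1.1
    rw [hst]; exact hn1 _
  have hx : ∀ n, ∃ x ∈ S n, F (n + 1) = insert (T x) (F n) := fun n => by
    change ∃ x ∈ (st n).1.1, (st (n + 1)).1.2 = _
    rw [hst]; exact hn2 _
  have hgood : ∀ n, ∀ x ∈ S (n + 1), ∀ y ∈ convexHull ℝ (F (n + 1)),
      1 + ‖y‖ - ε ≤ ‖x + y‖ := fun n => by
    change ∀ x ∈ (st (n + 1)).1.1, ∀ y ∈ convexHull ℝ (st (n + 1)).1.2, _
    rw [hst]; exact hn3 _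
  choose x hxS hxF using hx
  have hFmono : Monotone F := monotone_nat_of_le_succ fun n => by
    rw [hxF]; exact Set.subset_insert _ _
  have hxF' : ∀ n, T (x n) ∈ F (n + 1) := fun n => by rw [hxF]; exact Set.mem_insert _ _
  -- the weak cluster point
  obtain ⟨u, -, hu⟩ := IsCompact.exists_mapClusterPt_of_frequently hT
    (l := Filter.atTop) (f := fun n => (toWeakSpace ℝ Z (T (x n)) : WeakSpace ℝ Z))
    (Filter.Frequently.of_forall fun n => subset_closure ⟨x n, (hSs n).norm_le (hxS n), rfl⟩)
  rw [mapClusterPt_atTop_iff_forall_mem_closure] at hu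
  -- Mazur
  have mazur : ∀ C : Set Z, Convex ℝ C → (∃ N, ∀ n ≥ N, T (x n) ∈ C) →
      (toWeakSpace ℝ Z).symm u ∈ closure C := by
    rintro C hC ⟨N, hN⟩
    have h1 : u ∈ closure (toWeakSpace ℝ Z '' C) := by
      refine closure_mono ?_ (hu N)
      rintro _ ⟨n, hn, rfl⟩
      exact ⟨_, hN n hn, rfl⟩
    rw [← hC.toWeakSpace_closure ℝ] at h1
    obtain ⟨w, hw, rfl⟩ := h1
    simpa using hw
  obtain ⟨v, hv, hvu⟩ := Metric.mem_closure_iff.mp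
    (mazur (⋃ n, convexHull ℝ (F (n + 1)))
      (Directed.convex_iUnion (Monotone.directed_le fun a b hab =>
        convexHull_mono (hFmono (Nat.succ_le_succ hab))) fun n => convex_convexHull ℝ _)
      ⟨0, fun n _ => Set.mem_iUnion.mpr ⟨n, subset_convexHull ℝ _ (hxF' n)⟩⟩) ε hε
  obtain ⟨N, hvN⟩ := Set.mem_iUnion.mp hv
  obtain ⟨_, ⟨y, hy, rfl⟩, hyu⟩ := Metric.mem_closure_iff.mp
    (mazur (T '' S (N + 1)) ((hSs (N + 1)).convex.linear_image (T : Z →ₗ[ℝ] Z))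
      ⟨N + 1, fun n hn => ⟨x n, hSanti hn (hxS n), rfl⟩⟩) ε hε
  refine ⟨y, (hSs (N + 1)).norm_le hy, ?_⟩
  have b1 := hgood N y hy v hvN
  have b2 : ‖T‖ - ε ≤ ‖T y‖ := hS0n y (hSanti (Nat.zero_le (N + 1)) hy)
  have b3 : ‖T y - v‖ < 2 * ε := by
    rw [← dist_eq_norm]
    have := dist_triangle_left (T y) v ((toWeakSpace ℝ Z).symm u)
    linarith
  have b4 : ‖T y‖ ≤ ‖v‖ + ‖T y - v‖ := by
    have : T y = v + (T y - v) := by abel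
    calc ‖T y‖ = ‖v + (T y - v)‖ := by rw [← this]
      _ ≤ _ := norm_add_le _ _
  have b5 : ‖y + v‖ ≤ ‖y + T y‖ + ‖T y - v‖ := by
    have : y + v = (y + T y) - (T y - v) := by abel
    rw [this]; exact norm_sub_le _ _
  linarith

theorem daugavet_weaklyCompact (hD : DaugavetProperty Z) (T : Z →L[ℝ] Z)
    (hT : WeaklyCompactOperator T) : ‖ContinuousLinearMap.id ℝ Z + T‖ = 1 + ‖T‖ := by
  rcases (norm_nonneg T).eq_or_lt with h0 | h0
  · have : T = 0 := norm_eq_zero.mp h0.symm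
    subst this
    simpa using hD 0 0
  apply le_antisymm
  · exact (norm_add_le _ _).trans (by gcongr; exact ContinuousLinearMap.norm_id_le)
  · apply le_of_forall_pos_le_add
    intro δ hδ
    obtain ⟨x, hx, hx'⟩ := daugavet_weaklyCompact_aux hD T hT h0
      (ε := min (δ / 6) (‖T‖ / 2)) (by positivity) ((min_le_right _ _).trans_lt (by linarith))
    have h1 := (ContinuousLinearMap.id ℝ Z + T).le_opNorm x
    have h2 : (ContinuousLinearMap.id ℝ Z + T) x = x + T x := rfl
    rw [h2] at h1
    have := min_le_left (δ / 6) (‖T‖ / 2)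
    nlinarith [norm_nonneg (ContinuousLinearMap.id ℝ Z + T)]

theorem weaklyCompact_of_compact (T : Z →L[ℝ] Z) (hT : IsCompactOperator ⇑T) :
    WeaklyCompactOperator T := by
  obtain ⟨K, hK, hTK⟩ := IsCompactOperator.image_closedBall_subset_compact
    (f := (T : Z →ₗ[ℝ] Z)) hT 1
  have h1 : IsCompact (toWeakSpaceCLM ℝ Z '' K) := hK.image (toWeakSpaceCLM ℝ Z).continuous
  refine h1.closure_of_subset ?_
  rintro _ ⟨z, hz, rfl⟩
  exact ⟨T z, hTK ⟨z, by simpa using hz, rfl⟩, rfl⟩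

theorem rankOne_compact (z' : Z →L[ℝ] ℝ) (z : Z) :
    IsCompactOperator ⇑(z'.smulRight z) := 
  (isCompactOperator_of_locallyCompactSpace_rng
   (ContinuousLinearMap.toSpanSingleton ℝ z)).comp_clm z'

theorem norm_compBil_norming (B₀ : X →L[ℝ] Y →L[ℝ] Z)
    (hnorming : {z : Z | ∃ (x : X) (y : Y), ‖x‖ < 1 ∧ ‖y‖ < 1 ∧ B₀ x y = z} =
      Metric.ball (0 : Z) 1) (T : Z →L[ℝ] Z) : ‖compBil T B₀‖ = ‖T‖ := by
  have happ : ∀ x y, compBil T B₀ x y = T (B₀ x y) := fun x y => rfl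
  apply le_antisymm
  · rw [← ContinuousLinearMap.sSup_unit_ball_eq_norm]
    refine csSup_le ((Metric.nonempty_ball.mpr one_pos).image _) ?_
    rintro _ ⟨x, hx, rfl⟩
    change ‖compBil T B₀ x‖ ≤ _
    rw [← ContinuousLinearMap.sSup_unit_ball_eq_norm]
    refine csSup_le ((Metric.nonempty_ball.mpr one_pos).image _) ?_
    rintro _ ⟨y, hy, rfl⟩
    have hz : B₀ x y ∈ Metric.ball (0 : Z) 1 := by
      rw [← hnorming]
      exact ⟨x, y, by simpa using hx, by simpa using hy, rfl⟩
    rw [mem_ball_zero_iff] at hz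
    change ‖T (B₀ x y)‖ ≤ _
    have := T.le_opNorm (B₀ x y)
    nlinarith [norm_nonneg T]
  · rw [← ContinuousLinearMap.sSup_unit_ball_eq_norm T]
    refine csSup_le ((Metric.nonempty_ball.mpr one_pos).image _) ?_
    rintro _ ⟨z, hz, rfl⟩
    rw [← hnorming] at hz
    obtain ⟨x, y, hx, hy, rfl⟩ := hz
    change ‖compBil T B₀ x y‖ ≤ _
    have h1 := (compBil T B₀).le_opNorm₂ x y
    have h2 : ‖compBil T B₀‖ * ‖x‖ * ‖y‖ ≤ ‖compBil T B₀‖ * 1 * 1 := by gcongr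
    linarith

/-- for a norming bilinear map `B₀ : X × Y → Z`, the Daugavet
property of `Z` is equivalent to the `B₀`-Daugavet equation
`‖B₀ + T ∘ B₀‖ = 1 + ‖T ∘ B₀‖` for all rank-one `T`, for all compact `T`, and
for all weakly compact `T`. -/
theorem norming_bilinear_daugavet_tfae
    [CompleteSpace X] [CompleteSpace Y] [CompleteSpace Z]
    (B₀ : X →L[ℝ] Y →L[ℝ] Z)
    (hnorming : {z : Z | ∃ (x : X) (y : Y), ‖x‖ < 1 ∧ ‖y‖ < 1 ∧ B₀ x y = z} =
      Metric.ball (0 : Z) 1) :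
    (DaugavetProperty Z ↔
      ∀ (z' : Z →L[ℝ] ℝ) (z : Z),
        ‖B₀ + compBil (z'.smulRight z) B₀‖ = 1 + ‖compBil (z'.smulRight z) B₀‖) ∧
    (DaugavetProperty Z ↔
      ∀ T : Z →L[ℝ] Z, IsCompactOperator ⇑T →
        ‖B₀ + compBil T B₀‖ = 1 + ‖compBil T B₀‖) ∧
    (DaugavetProperty Z ↔
      ∀ T : Z →L[ℝ] Z, WeaklyCompactOperator T →
        ‖B₀ + compBil T B₀‖ = 1 + ‖compBil T B₀‖) := by
  have hn := norm_compBil_norming B₀ hnorming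
  have hadd : ∀ T : Z →L[ℝ] Z,
      B₀ + compBil T B₀ = compBil (ContinuousLinearMap.id ℝ Z + T) B₀ := by
    intro T
    ext x y
    rfl
  simp only [hadd, hn]
  have h14 := fun hD : DaugavetProperty Z => daugavet_weaklyCompact hD
  refine ⟨Iff.rfl, ⟨fun hD T hT => h14 hD T (weaklyCompact_of_compact T hT), ?_⟩, ⟨h14, ?_⟩⟩
  · exact fun h z' z => h _ (rankOne_compact z' z)
  · exact fun h z' z => h _ (weaklyCompact_of_compact _ (rankOne_compact z' z))
end

section
/- Let X(μ) be an order continuous constant-1 p-convex Banach function space over a finite measure in which simple functions are dense, and let B : X × X_{[p/p']} → X_{[p]} be a continuous bilinear map. Then B is symmetric (i.e., B(χ_A, χ_C) = B(χ_{A∩C}, χ_{A∪C}) for all measurable A, C) if and only if there exists a bounded operator T : X_{[p]} → X_{[p]} such that B(f, g) = T(f·g) for all f ∈ X, g ∈ X_{[p/p']}. -/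
open MeasureTheory

variable {α : Type*} [MeasurableSpace α] {μ : Measure α}

/-- The (absolute-value) `r`-th power `|f|^r` of an a.e.-equivalence class of
functions, computed pointwise. -/
noncomputable def pw (r : ℝ) (f : α →ₘ[μ] ℝ) : α →ₘ[μ] ℝ :=
  AEEqFun.compMeasurable (fun x : ℝ => |x| ^ r) (by fun_prop) f

/-- The sign-preserving `r`-th power `f^r = sign(f)·|f|^r`, computed
pointwise. -/
noncomputable def spw (r : ℝ) (f : α →ₘ[μ] ℝ) : α →ₘ[μ] ℝ :=
  AEEqFun.compMeasurable (fun x : ℝ => Real.sign x * |x| ^ r)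
    (by
      apply Measurable.mul
      · unfold Real.sign
        exact Measurable.ite measurableSet_Iio measurable_const
          (Measurable.ite measurableSet_Ioi measurable_const measurable_const)
      · fun_prop)
    f

/-- A Banach function space over a measure `μ`: an order ideal of `L⁰(μ)` with a
complete lattice norm containing the characteristic functions of sets of finite
measure. -/
structure BanachFunctionSpace (α : Type*) [MeasurableSpace α]
    (μ : Measure α) where
  Mem : (α →ₘ[μ] ℝ) → Prop
  N : (α →ₘ[μ] ℝ) → ℝ
  mem_zero : Mem 0
  mem_add : ∀ {f g}, Mem f → Mem g → Mem (f + g)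
  mem_smul : ∀ (c : ℝ) {f}, Mem f → Mem (c • f)
  N_nonneg : ∀ f, 0 ≤ N f
  N_eq_zero_iff : ∀ {f}, Mem f → (N f = 0 ↔ f = 0)
  N_add_le : ∀ {f g}, Mem f → Mem g → N (f + g) ≤ N f + N g
  N_smul : ∀ (c : ℝ) (f), N (c • f) = |c| * N f
  mem_of_le : ∀ {f g}, Mem f → |g| ≤ |f| → Mem g
  N_mono : ∀ {f g}, Mem f → |g| ≤ |f| → N g ≤ N f
  mem_indicator : ∀ (A : Set α) (hA : MeasurableSet A), μ A < ⊤ →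
    Mem (AEEqFun.mk (A.indicator fun _ => (1 : ℝ))
      ((measurable_const.indicator hA).aestronglyMeasurable))
  complete : ∀ f : ℕ → (α →ₘ[μ] ℝ), (∀ n, Mem (f n)) →
    (∀ ε > (0 : ℝ), ∃ N₀ : ℕ, ∀ m n, N₀ ≤ m → N₀ ≤ n → N (f m - f n) < ε) →
    ∃ g, Mem g ∧ Filter.Tendsto (fun n => N (f n - g)) Filter.atTop (nhds 0)

namespace BanachFunctionSpace

variable (X : BanachFunctionSpace α μ)

/-- Membership in the `r`-th power space `X_{[r]} = {h : |h|^{1/r} ∈ X}`. -/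
def MemPow (r : ℝ) (h : α →ₘ[μ] ℝ) : Prop := X.Mem (pw r⁻¹ h)

/-- The norm `‖h‖_{X_{[r]}} = ‖|h|^{1/r}‖_X^r` of the `r`-th power space. -/
noncomputable def NPow (r : ℝ) (h : α →ₘ[μ] ℝ) : ℝ := X.N (pw r⁻¹ h) ^ r

/-- `X` is `p`-convex with constant 1. -/
def PConvex1 (p : ℝ) : Prop :=
  ∀ (n : ℕ) (f : Fin n → (α →ₘ[μ] ℝ)), (∀ i, X.Mem (f i)) →
    X.Mem (pw p⁻¹ (∑ i, pw p (f i))) ∧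
      X.N (pw p⁻¹ (∑ i, pw p (f i))) ≤ (∑ i, X.N (f i) ^ p) ^ p⁻¹

/-- `X` is `p`-concave with constant 1. -/
def PConcave1 (p : ℝ) : Prop :=
  ∀ (n : ℕ) (f : Fin n → (α →ₘ[μ] ℝ)), (∀ i, X.Mem (f i)) →
    (∑ i, X.N (f i) ^ p) ^ p⁻¹ ≤ X.N (pw p⁻¹ (∑ i, pw p (f i)))

/-- `X` is order continuous: norms of decreasing sequences with infimum `0`
tend to `0`. -/
def OrderCont : Prop :=
  ∀ f : ℕ → (α →ₘ[μ] ℝ), (∀ n, X.Mem (f n)) → (∀ n, f (n + 1) ≤ f n) →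
    (∀ n, 0 ≤ f n) → (∀ g : (α →ₘ[μ] ℝ), (∀ n, g ≤ f n) → g ≤ 0) →
    Filter.Tendsto (fun n => X.N (f n)) Filter.atTop (nhds 0)

/-- A bounded linear operator on the `p`-th power space `X_{[p]}`. -/
def IsBoundedOpPow (p : ℝ) (T : (α →ₘ[μ] ℝ) → (α →ₘ[μ] ℝ)) : Prop :=
  (∀ h, X.MemPow p h → X.MemPow p (T h)) ∧
  (∀ h k, X.MemPow p h → X.MemPow p k → T (h + k) = T h + T k) ∧
  (∀ (c : ℝ) h, X.MemPow p h → T (c • h) = c • T h) ∧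
  ∃ C : ℝ, ∀ h, X.MemPow p h → X.NPow p (T h) ≤ C * X.NPow p h

/-- The operator norm of a map on the `p`-th power space `X_{[p]}`. -/
noncomputable def opNPow (p : ℝ) (T : (α →ₘ[μ] ℝ) → (α →ₘ[μ] ℝ)) : ℝ :=
  sSup {r | ∃ h, X.MemPow p h ∧ X.NPow p h ≤ 1 ∧ r = X.NPow p (T h)}

/-- A rank-one bounded operator on `X_{[p]}`: `T h = φ(h) • z₀` for a bounded
linear functional `φ` on `X_{[p]}` and some `z₀ ∈ X_{[p]}`. -/
def IsRankOnePow (p : ℝ) (T : (α →ₘ[μ] ℝ) → (α →ₘ[μ] ℝ)) : Prop :=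
  ∃ (φ : (α →ₘ[μ] ℝ) → ℝ) (z₀ : α →ₘ[μ] ℝ),
    (∀ h k, X.MemPow p h → X.MemPow p k → φ (h + k) = φ h + φ k) ∧
    (∀ (c : ℝ) h, X.MemPow p h → φ (c • h) = c * φ h) ∧
    (∃ C : ℝ, ∀ h, X.MemPow p h → |φ h| ≤ C * X.NPow p h) ∧
    X.MemPow p z₀ ∧ ∀ h, X.MemPow p h → T h = φ h • z₀

end BanachFunctionSpace

namespace BanachFunctionSpace

/-- Characteristic function of a measurable set. -/
noncomputable abbrev chi (μ : Measure α) (A : Set α) (hA : MeasurableSet A) : α →ₘ[μ] ℝ :=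
  AEEqFun.mk (A.indicator fun _ => (1 : ℝ))
    ((measurable_const.indicator hA).aestronglyMeasurable)

/-- The class of a simple function. -/
noncomputable abbrev sf (μ : Measure α) (s : SimpleFunc α ℝ) : α →ₘ[μ] ℝ :=
  AEEqFun.mk s s.aestronglyMeasurable

lemma pw_coe (r : ℝ) (f : α →ₘ[μ] ℝ) : ∀ᵐ x ∂μ, pw r f x = |f x| ^ r :=
  AEEqFun.coeFn_compMeasurable _ _ f

lemma spw_coe (r : ℝ) (f : α →ₘ[μ] ℝ) : ∀ᵐ x ∂μ, spw r f x = Real.sign (f x) * |f x| ^ r :=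
  AEEqFun.coeFn_compMeasurable _ _ f

lemma abs_le_abs_of_ae {f g : α →ₘ[μ] ℝ} (h : ∀ᵐ x ∂μ, |g x| ≤ |f x|) : |g| ≤ |f| := by
  rw [← AEEqFun.coeFn_le]
  filter_upwards [h, AEEqFun.coeFn_abs f, AEEqFun.coeFn_abs g] with x h1 h2 h3
  rw [h2, h3]; exact h1

lemma mul_coe (f g : α →ₘ[μ] ℝ) : ∀ᵐ x ∂μ, (f * g) x = f x * g x := AEEqFun.coeFn_mul f g
lemma add_coe (f g : α →ₘ[μ] ℝ) : ∀ᵐ x ∂μ, (f + g) x = f x + g x := AEEqFun.coeFn_add f g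
lemma sub_coe (f g : α →ₘ[μ] ℝ) : ∀ᵐ x ∂μ, (f - g) x = f x - g x := AEEqFun.coeFn_sub f g
lemma smul_coe (c : ℝ) (f : α →ₘ[μ] ℝ) : ∀ᵐ x ∂μ, (c • f) x = c * f x := AEEqFun.coeFn_smul c f
lemma one_coe : ∀ᵐ x ∂μ, (1 : α →ₘ[μ] ℝ) x = 1 := AEEqFun.coeFn_one
lemma zero_coe : ∀ᵐ x ∂μ, (0 : α →ₘ[μ] ℝ) x = 0 := AEEqFun.coeFn_zero

variable (X : BanachFunctionSpace α μ)
variable {X}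

lemma mem_ae {f g : α →ₘ[μ] ℝ} (hf : X.Mem f) (h : ∀ᵐ x ∂μ, |g x| ≤ |f x|) : X.Mem g :=
  X.mem_of_le hf (abs_le_abs_of_ae h)

lemma N_ae {f g : α →ₘ[μ] ℝ} (hf : X.Mem f) (h : ∀ᵐ x ∂μ, |g x| ≤ |f x|) : X.N g ≤ X.N f :=
  X.N_mono hf (abs_le_abs_of_ae h)

lemma NPow_nonneg (r : ℝ) (f : α →ₘ[μ] ℝ) : 0 ≤ X.NPow r f := Real.rpow_nonneg (X.N_nonneg _) _

lemma pw_ae {r : ℝ} (hr : 0 ≤ r) {f g : α →ₘ[μ] ℝ} (h : ∀ᵐ x ∂μ, |g x| ≤ |f x|) :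
    ∀ᵐ x ∂μ, |pw r g x| ≤ |pw r f x| := by
  filter_upwards [h, pw_coe r f, pw_coe r g] with x h1 h2 h3
  rw [h2, h3, abs_of_nonneg (a := |g x| ^ r) (by positivity),
    abs_of_nonneg (a := |f x| ^ r) (by positivity)]
  gcongr

lemma memPow_ae {r : ℝ} (hr : 0 < r) {f g : α →ₘ[μ] ℝ} (hf : X.MemPow r f)
    (h : ∀ᵐ x ∂μ, |g x| ≤ |f x|) : X.MemPow r g :=
  mem_ae hf (pw_ae (by positivity) h)

lemma NPow_ae {r : ℝ} (hr : 0 < r) {f g : α →ₘ[μ] ℝ} (hf : X.MemPow r f)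
    (h : ∀ᵐ x ∂μ, |g x| ≤ |f x|) : X.NPow r g ≤ X.NPow r f :=
  Real.rpow_le_rpow (X.N_nonneg _) (N_ae hf (pw_ae (by positivity) h)) hr.le

lemma add_rpow_le {a b s : ℝ} (ha : 0 ≤ a) (hb : 0 ≤ b) (hs : 0 < s) :
    (a + b) ^ s ≤ 2 ^ s * (a ^ s + b ^ s) := by
  have h1 : 0 ≤ a ^ s := by positivity
  have h2 : 0 ≤ b ^ s := by positivity
  have h3 : (0:ℝ) ≤ 2 ^ s := by positivity
  rcases le_total a b with h | h
  · calc (a + b) ^ s ≤ (2 * b) ^ s := by gcongr; linarith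
      _ = 2 ^ s * b ^ s := Real.mul_rpow (by norm_num) hb
      _ ≤ _ := by nlinarith
  · calc (a + b) ^ s ≤ (2 * a) ^ s := by gcongr; linarith
      _ = 2 ^ s * a ^ s := Real.mul_rpow (by norm_num) ha
      _ ≤ _ := by nlinarith

lemma pw_add_ae {s : ℝ} (hs : 0 < s) (f g : α →ₘ[μ] ℝ) :
    ∀ᵐ x ∂μ, |pw s (f + g) x| ≤ |((2:ℝ) ^ s • (pw s f + pw s g)) x| := by
  filter_upwards [pw_coe s f, pw_coe s g, pw_coe s (f + g), add_coe f g,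
    add_coe (pw s f) (pw s g), smul_coe ((2:ℝ) ^ s) (pw s f + pw s g)] with x h1 h2 h3 h4 h5 h6
  rw [h6, h5, h3, h4, h1, h2, abs_of_nonneg (a := |f x + g x| ^ s) (by positivity),
    abs_of_nonneg (a := 2 ^ s * (|f x| ^ s + |g x| ^ s)) (by positivity)]
  refine le_trans ?_ (add_rpow_le (abs_nonneg _) (abs_nonneg _) hs)
  gcongr
  exact abs_add_le _ _

lemma memPow_add {r : ℝ} (hr : 0 < r) {f g : α →ₘ[μ] ℝ} (hf : X.MemPow r f)
    (hg : X.MemPow r g) : X.MemPow r (f + g) :=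
  mem_ae (X.mem_smul _ (X.mem_add hf hg)) (pw_add_ae (inv_pos.2 hr) f g)

lemma NPow_add {r : ℝ} (hr : 0 < r) {f g : α →ₘ[μ] ℝ} (hf : X.MemPow r f)
    (hg : X.MemPow r g) : X.NPow r (f + g) ≤ 2 * 2 ^ r * (X.NPow r f + X.NPow r g) := by
  have h := N_ae (X.mem_smul _ (X.mem_add hf hg)) (pw_add_ae (inv_pos.2 hr) f g)
  rw [X.N_smul] at h
  have h2 := X.N_add_le hf hg
  have hp : (0:ℝ) < 2 ^ r⁻¹ := by positivity
  rw [abs_of_pos hp] at h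
  have h3 : X.N (pw r⁻¹ (f + g)) ≤ 2 ^ r⁻¹ * (X.N (pw r⁻¹ f) + X.N (pw r⁻¹ g)) :=
    h.trans (by gcongr)
  have n1 := X.N_nonneg (pw r⁻¹ f)
  have n2 := X.N_nonneg (pw r⁻¹ g)
  unfold NPow
  calc X.N (pw r⁻¹ (f + g)) ^ r ≤ (2 ^ r⁻¹ * (X.N (pw r⁻¹ f) + X.N (pw r⁻¹ g))) ^ r := by
        have := X.N_nonneg (pw r⁻¹ (f + g))
        gcongr
    _ = 2 * (X.N (pw r⁻¹ f) + X.N (pw r⁻¹ g)) ^ r := by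
        rw [Real.mul_rpow hp.le (by positivity), ← Real.rpow_mul (by norm_num),
          inv_mul_cancel₀ hr.ne', Real.rpow_one]
    _ ≤ _ := by
        have := add_rpow_le n1 n2 hr
        linarith

lemma pw_smul (s c : ℝ) (f : α →ₘ[μ] ℝ) : pw s (c • f) = |c| ^ s • pw s f := by
  apply AEEqFun.ext
  filter_upwards [pw_coe s f, pw_coe s (c • f), smul_coe c f, smul_coe (|c| ^ s) (pw s f)]
    with x h1 h2 h3 h4
  rw [h4, h2, h3, h1, abs_mul, Real.mul_rpow (abs_nonneg _) (abs_nonneg _)]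

lemma memPow_smul {r : ℝ} (c : ℝ) {f : α →ₘ[μ] ℝ} (hf : X.MemPow r f) :
    X.MemPow r (c • f) := by
  unfold MemPow; rw [pw_smul]; exact X.mem_smul _ hf

lemma NPow_smul {r : ℝ} (hr : 0 < r) (c : ℝ) (f : α →ₘ[μ] ℝ) :
    X.NPow r (c • f) = |c| * X.NPow r f := by
  unfold NPow
  rw [pw_smul, X.N_smul, abs_of_nonneg (by positivity), Real.mul_rpow (by positivity)
    (X.N_nonneg _), ← Real.rpow_mul (abs_nonneg _), inv_mul_cancel₀ hr.ne', Real.rpow_one]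

lemma memPow_sub {r : ℝ} (hr : 0 < r) {f g : α →ₘ[μ] ℝ} (hf : X.MemPow r f)
    (hg : X.MemPow r g) : X.MemPow r (f - g) := by
  have : f - g = f + (-1 : ℝ) • g := by rw [neg_one_smul, sub_eq_add_neg]
  rw [this]; exact memPow_add hr hf (memPow_smul _ hg)

lemma mem_sub {f g : α →ₘ[μ] ℝ} (hf : X.Mem f) (hg : X.Mem g) : X.Mem (f - g) := by
  have : f - g = f + (-1 : ℝ) • g := by rw [neg_one_smul, sub_eq_add_neg]
  rw [this]; exact X.mem_add hf (X.mem_smul _ hg)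

lemma NPow_sub {r : ℝ} (hr : 0 < r) {f g : α →ₘ[μ] ℝ} (hf : X.MemPow r f)
    (hg : X.MemPow r g) : X.NPow r (f - g) ≤ 2 * 2 ^ r * (X.NPow r f + X.NPow r g) := by
  have : f - g = f + (-1 : ℝ) • g := by rw [neg_one_smul, sub_eq_add_neg]
  rw [this]
  have h := NPow_add hr hf (memPow_smul (-1) hg)
  rwa [NPow_smul hr, abs_neg, abs_one, one_mul] at h

lemma eq_zero_of_NPow {r : ℝ} (hr : 0 < r) {f : α →ₘ[μ] ℝ} (hf : X.MemPow r f)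
    (h : X.NPow r f = 0) : f = 0 := by
  unfold NPow at h
  have h1 : X.N (pw r⁻¹ f) = 0 := (Real.rpow_eq_zero (X.N_nonneg _) hr.ne').1 h
  have h2 := (X.N_eq_zero_iff hf).1 h1
  apply AEEqFun.ext
  have h3 := pw_coe r⁻¹ f
  rw [h2] at h3
  filter_upwards [h3, zero_coe (μ := μ)] with x h4 h5
  rw [h5] at h4 ⊢
  have := (Real.rpow_eq_zero (abs_nonneg _) (inv_pos.2 hr).ne').1 h4.symm
  exact abs_eq_zero.1 this

lemma mem_one [IsFiniteMeasure μ] : X.Mem (1 : α →ₘ[μ] ℝ) := by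
  have h := X.mem_indicator Set.univ MeasurableSet.univ (measure_lt_top _ _)
  convert h using 1
  apply AEEqFun.ext
  filter_upwards [one_coe (μ := μ), AEEqFun.coeFn_mk (μ := μ) (Set.univ.indicator fun _ => (1 : ℝ))
    ((measurable_const.indicator MeasurableSet.univ).aestronglyMeasurable)] with x h1 h2
  rw [h1, h2]; simp

lemma memPow_one [IsFiniteMeasure μ] (r : ℝ) : X.MemPow r (1 : α →ₘ[μ] ℝ) := by
  refine mem_ae mem_one ?_
  filter_upwards [one_coe (μ := μ), pw_coe r⁻¹ (1 : α →ₘ[μ] ℝ)] with x h1 h2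
  rw [h2, h1]; simp

lemma mem_bdd [IsFiniteMeasure μ] {f : α →ₘ[μ] ℝ} {c : ℝ} (h : ∀ᵐ x ∂μ, |f x| ≤ c) :
    X.Mem f := by
  refine mem_ae (X.mem_smul c mem_one) ?_
  filter_upwards [h, one_coe (μ := μ), smul_coe c (1 : α →ₘ[μ] ℝ)] with x h1 h2 h3
  rw [h3, h2, mul_one]; exact h1.trans (le_abs_self _)

lemma memPow_bdd [IsFiniteMeasure μ] {r : ℝ} (hr : 0 < r) {f : α →ₘ[μ] ℝ} {c : ℝ}
    (h : ∀ᵐ x ∂μ, |f x| ≤ c) : X.MemPow r f := by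
  refine memPow_ae hr (memPow_smul c (memPow_one r)) ?_
  filter_upwards [h, one_coe (μ := μ), smul_coe c (1 : α →ₘ[μ] ℝ)] with x h1 h2 h3
  rw [h3, h2, mul_one]; exact h1.trans (le_abs_self _)

lemma NPow_bdd [IsFiniteMeasure μ] {r : ℝ} (hr : 0 < r) {f : α →ₘ[μ] ℝ} {c : ℝ} (hc : 0 ≤ c)
    (h : ∀ᵐ x ∂μ, |f x| ≤ c) : X.NPow r f ≤ c * X.NPow r (1 : α →ₘ[μ] ℝ) := by
  have := NPow_ae (g := f) hr (memPow_smul (X := X) c (memPow_one r)) ?_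
  · rwa [NPow_smul hr, abs_of_nonneg hc] at this
  filter_upwards [h, one_coe (μ := μ), smul_coe c (1 : α →ₘ[μ] ℝ)] with x h1 h2 h3
  rw [h3, h2, mul_one]; exact h1.trans (le_abs_self _)

lemma mul_bdd_ae {f t : α →ₘ[μ] ℝ} {c : ℝ} (h : ∀ᵐ x ∂μ, |t x| ≤ c) :
    ∀ᵐ x ∂μ, |(f * t) x| ≤ |(c • f) x| := by
  filter_upwards [h, mul_coe f t, smul_coe c f] with x h1 h2 h3
  rw [h2, h3, abs_mul, abs_mul, mul_comm]
  exact mul_le_mul_of_nonneg_right (h1.trans (le_abs_self _)) (abs_nonneg _)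

lemma mem_mul {f t : α →ₘ[μ] ℝ} {c : ℝ} (hf : X.Mem f) (h : ∀ᵐ x ∂μ, |t x| ≤ c) :
    X.Mem (f * t) := mem_ae (X.mem_smul c hf) (mul_bdd_ae h)

lemma N_mul {f t : α →ₘ[μ] ℝ} {c : ℝ} (hc : 0 ≤ c) (hf : X.Mem f) (h : ∀ᵐ x ∂μ, |t x| ≤ c) :
    X.N (f * t) ≤ c * X.N f := by
  have := N_ae (X.mem_smul c hf) (mul_bdd_ae h)
  rwa [X.N_smul, abs_of_nonneg hc] at this

lemma memPow_mul {r : ℝ} (hr : 0 < r) {f t : α →ₘ[μ] ℝ} {c : ℝ} (hf : X.MemPow r f)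
    (h : ∀ᵐ x ∂μ, |t x| ≤ c) : X.MemPow r (f * t) :=
  memPow_ae hr (memPow_smul c hf) (mul_bdd_ae h)

lemma NPow_mul {r : ℝ} (hr : 0 < r) {f t : α →ₘ[μ] ℝ} {c : ℝ} (hc : 0 ≤ c) (hf : X.MemPow r f)
    (h : ∀ᵐ x ∂μ, |t x| ≤ c) : X.NPow r (f * t) ≤ c * X.NPow r f := by
  have := NPow_ae hr (memPow_smul c hf) (mul_bdd_ae h)
  rwa [NPow_smul hr, abs_of_nonneg hc] at this

lemma sf_bdd (s : SimpleFunc α ℝ) : ∃ c : ℝ, 0 ≤ c ∧ ∀ᵐ x ∂μ, |sf μ s x| ≤ c := by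
  obtain ⟨c, hc⟩ := s.exists_forall_norm_le
  refine ⟨max c 0, le_max_right _ _, ?_⟩
  filter_upwards [AEEqFun.coeFn_mk (μ := μ) s s.aestronglyMeasurable] with x h
  rw [h]; exact (hc x).trans (le_max_left _ _)

lemma exists_sf {t : α →ₘ[μ] ℝ} {c : ℝ} (h : ∀ᵐ x ∂μ, |t x| ≤ c) {ε : ℝ} (hε : 0 < ε) :
    ∃ s : SimpleFunc α ℝ, ∀ᵐ x ∂μ, |(t - sf μ s) x| ≤ ε := by
  let φ : ℝ → ℝ := fun y => ε * ⌊max (-c) (min c y) / ε⌋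
  have hφ : Measurable φ := by
    have : Measurable fun y : ℝ => ⌊max (-c) (min c y) / ε⌋ := by
      apply Measurable.floor; fun_prop
    exact (Measurable.comp (measurable_of_countable (fun n : ℤ => (n : ℝ))) this).const_mul ε
  have hφr : (Set.range φ).Finite := by
    refine ((Set.finite_Icc ⌊-|c| / ε⌋ ⌊|c| / ε⌋).image (fun n : ℤ => ε * (n:ℝ))).subset ?_
    rintro _ ⟨y, rfl⟩
    refine ⟨⌊max (-c) (min c y) / ε⌋, ⟨?_, ?_⟩, rfl⟩
    · apply Int.floor_mono
      gcongr
      exact le_trans (neg_le_neg (le_abs_self c)) (le_max_left _ _)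
    · apply Int.floor_mono
      gcongr
      exact max_le (neg_le_abs c) ((min_le_left _ _).trans (le_abs_self c))
  let s : SimpleFunc α ℝ :=
    { toFun := fun x => φ (t x)
      measurableSet_fiber' := fun y => (hφ.comp t.measurable) (measurableSet_singleton y)
      finite_range' := hφr.subset (by rintro _ ⟨x, rfl⟩; exact ⟨t x, rfl⟩) }
  refine ⟨s, ?_⟩
  filter_upwards [h, sub_coe t (sf μ s), AEEqFun.coeFn_mk (μ := μ) s s.aestronglyMeasurable]
    with x h1 h2 h3
  rw [h2, h3]
  change |t x - ε * ⌊max (-c) (min c (t x)) / ε⌋| ≤ ε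
  rw [abs_le] at h1
  rw [min_eq_right h1.2, max_eq_right h1.1]
  have h4 := Int.floor_le (t x / ε)
  have h5 := Int.lt_floor_add_one (t x / ε)
  rw [le_div_iff₀ hε] at h4
  rw [div_lt_iff₀ hε] at h5
  rw [abs_le]; constructor <;> nlinarith

lemma exists_trunc (hoc : X.OrderCont) {r : ℝ} (hr : 0 < r) {g : α →ₘ[μ] ℝ} (hg : X.MemPow r g)
    {ε : ℝ} (hε : 0 < ε) :
    ∃ (k : α →ₘ[μ] ℝ) (c : ℝ), (∀ᵐ x ∂μ, |k x| ≤ c) ∧ X.MemPow r k ∧ X.NPow r (g - k) < ε := by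
  let φ : ℕ → ℝ → ℝ := fun n y => if |y| ≤ n then y else 0
  have hφ : ∀ n, Measurable (φ n) := fun n =>
    Measurable.ite (measurableSet_le (by fun_prop) (by fun_prop)) measurable_id measurable_const
  let k : ℕ → (α →ₘ[μ] ℝ) := fun n => AEEqFun.compMeasurable (φ n) (hφ n) g
  have hk : ∀ n, ∀ᵐ x ∂μ, k n x = φ n (g x) := fun n => AEEqFun.coeFn_compMeasurable _ _ g
  have hkm : ∀ n, X.MemPow r (k n) := fun n => memPow_ae hr hg (by
    filter_upwards [hk n] with x h
    rw [h]; simp only [φ]; split_ifs <;> simp)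
  let F : ℕ → (α →ₘ[μ] ℝ) := fun n => pw r⁻¹ (g - k n)
  have hF : ∀ n, ∀ᵐ x ∂μ, F n x = if |g x| ≤ n then 0 else |g x| ^ r⁻¹ := fun n => by
    filter_upwards [hk n, sub_coe g (k n), pw_coe r⁻¹ (g - k n)] with x h1 h2 h3
    simp only [F]
    rw [h3, h2, h1]; simp only [φ]
    split_ifs <;> simp [hr.ne']
  have hT := hoc F (fun n => memPow_sub hr hg (hkm n)) (fun n => by
      rw [← AEEqFun.coeFn_le]
      filter_upwards [hF n, hF (n+1)] with x h1 h2
      rw [h1, h2]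
      push_cast
      have : 0 ≤ |g x| ^ r⁻¹ := by positivity
      split_ifs <;> linarith) (fun n => by
      rw [← AEEqFun.coeFn_le]
      filter_upwards [hF n, zero_coe (μ := μ)] with x h1 h2
      rw [h1, h2]
      split_ifs <;> positivity) (fun u hu => by
      rw [← AEEqFun.coeFn_le]
      have hu' : ∀ᵐ x ∂μ, ∀ n, u x ≤ F n x := ae_all_iff.2 fun n => AEEqFun.coeFn_le.2 (hu n)
      filter_upwards [ae_all_iff.2 hF, hu', zero_coe (μ := μ)] with x h1 h2 h3
      obtain ⟨n, hn⟩ := exists_nat_ge |g x|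
      have := h2 n
      rw [h1 n, if_pos hn] at this
      rw [h3]; exact this)
  have hT2 : Filter.Tendsto (fun n => X.NPow r (g - k n)) Filter.atTop (nhds 0) := by
    have := hT.rpow_const (p := r) (Or.inr hr.le)
    rwa [Real.zero_rpow hr.ne'] at this
  obtain ⟨n, hn⟩ := (hT2.eventually (gt_mem_nhds hε)).exists
  refine ⟨k n, n, ?_, hkm n, hn⟩
  filter_upwards [hk n] with x h
  rw [h]; simp only [φ]; split_ifs with h'
  · exact h'
  · simp

lemma ae_mul_add (f g h : α →ₘ[μ] ℝ) : f * (g + h) = f * g + f * h := by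
  apply AEEqFun.ext
  filter_upwards [mul_coe f (g + h), add_coe g h, add_coe (f * g) (f * h), mul_coe f g,
    mul_coe f h] with x h1 h2 h3 h4 h5
  rw [h1, h2, h3, h4, h5, mul_add]

lemma ae_add_mul (f g h : α →ₘ[μ] ℝ) : (f + g) * h = f * h + g * h := by
  rw [mul_comm, ae_mul_add, mul_comm h, mul_comm h]

lemma ae_mul_sub (f g h : α →ₘ[μ] ℝ) : f * (g - h) = f * g - f * h := by
  rw [eq_sub_iff_add_eq, ← ae_mul_add, sub_add_cancel]

lemma ae_sub_mul (f g h : α →ₘ[μ] ℝ) : (f - g) * h = f * h - g * h := by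
  rw [mul_comm, ae_mul_sub, mul_comm h, mul_comm h]

lemma ae_mul_smul (c : ℝ) (f g : α →ₘ[μ] ℝ) : f * (c • g) = c • (f * g) := by
  apply AEEqFun.ext
  filter_upwards [mul_coe f (c • g), smul_coe c g, smul_coe c (f * g), mul_coe f g]
    with x h1 h2 h3 h4
  rw [h1, h2, h3, h4]; ring

lemma ae_smul_mul (c : ℝ) (f g : α →ₘ[μ] ℝ) : (c • f) * g = c • (f * g) := by
  rw [mul_comm, ae_mul_smul, mul_comm]

/-- The hypotheses on the bilinear map, for `p = 1 + r`. -/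
structure BH (X : BanachFunctionSpace α μ) (p r C : ℝ)
    (B : (α →ₘ[μ] ℝ) → (α →ₘ[μ] ℝ) → (α →ₘ[μ] ℝ)) : Prop where
  hr : 0 < r
  hp : p = 1 + r
  hC : 0 ≤ C
  mem : ∀ {f g}, X.Mem f → X.MemPow r g → X.MemPow p (B f g)
  add₁ : ∀ {f₁ f₂ g}, X.Mem f₁ → X.Mem f₂ → X.MemPow r g →
      B (f₁ + f₂) g = B f₁ g + B f₂ g
  add₂ : ∀ {f g₁ g₂}, X.Mem f → X.MemPow r g₁ → X.MemPow r g₂ →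
      B f (g₁ + g₂) = B f g₁ + B f g₂
  smul₁ : ∀ (c : ℝ) {f g}, X.Mem f → X.MemPow r g → B (c • f) g = c • B f g
  smul₂ : ∀ (c : ℝ) {f g}, X.Mem f → X.MemPow r g → B f (c • g) = c • B f g
  bdd : ∀ {f g}, X.Mem f → X.MemPow r g → X.NPow p (B f g) ≤ C * X.N f * X.NPow r g
  oc : X.OrderCont
  dense : ∀ f, X.Mem f → ∀ ε > (0 : ℝ), ∃ s : SimpleFunc α ℝ,
      X.Mem (sf μ s) ∧ X.N (f - sf μ s) < ε
  sym : ∀ (A C : Set α) (hA : MeasurableSet A) (hC : MeasurableSet C),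
      B (chi μ A hA) (chi μ C hC) = B (chi μ _ (hA.inter hC)) (chi μ _ (hA.union hC))

namespace BH

variable {p r C : ℝ} {B : (α →ₘ[μ] ℝ) → (α →ₘ[μ] ℝ) → (α →ₘ[μ] ℝ)}

lemma sub₁ (H : BH X p r C B) {f₁ f₂ g} (h1 : X.Mem f₁) (h2 : X.Mem f₂) (hg : X.MemPow r g) :
    B (f₁ - f₂) g = B f₁ g - B f₂ g := by
  have h := H.add₁ (mem_sub h1 h2) h2 hg
  rw [sub_add_cancel] at h
  rw [h, add_sub_cancel_right]

lemma sub₂ (H : BH X p r C B) {f g₁ g₂} (hf : X.Mem f) (h1 : X.MemPow r g₁)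
    (h2 : X.MemPow r g₂) : B f (g₁ - g₂) = B f g₁ - B f g₂ := by
  have h := H.add₂ hf (memPow_sub H.hr h1 h2) h2
  rw [sub_add_cancel] at h
  rw [h, add_sub_cancel_right]

lemma zero₁ (H : BH X p r C B) {g} (hg : X.MemPow r g) : B 0 g = 0 := by
  have := H.smul₁ 0 X.mem_zero hg
  simpa using this

lemma hp0 (H : BH X p r C B) : 0 < p := by have := H.hr; have := H.hp; linarith

lemma eq_of_small (H : BH X p r C B) {f g f' g'} (hf : X.Mem f) (hg : X.MemPow r g)
    (hf' : X.Mem f') (hg' : X.MemPow r g') (K : ℝ)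
    (h : ∀ ε > (0:ℝ), ∃ a b a' b', X.Mem a ∧ X.MemPow r b ∧ X.Mem a' ∧ X.MemPow r b' ∧
      B f g - B f' g' = B a b - B a' b' ∧ X.N a * X.NPow r b ≤ K * ε ∧
      X.N a' * X.NPow r b' ≤ K * ε) : B f g = B f' g' := by
  have hp0 := H.hp0
  have hm := memPow_sub hp0 (H.mem hf hg) (H.mem hf' hg')
  rw [← sub_eq_zero]
  apply eq_zero_of_NPow hp0 hm
  apply le_antisymm _ (NPow_nonneg _ _)
  have key : ∀ ε > (0:ℝ), X.NPow p (B f g - B f' g') ≤ (2 * 2 ^ p * (2 * (C * K))) * ε := by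
    intro ε hε
    obtain ⟨a, b, a', b', ha, hb, ha', hb', he, h1, h2⟩ := h ε hε
    rw [he]
    have h3 := NPow_sub hp0 (H.mem ha hb) (H.mem ha' hb')
    have h4 := H.bdd ha hb
    have h5 := H.bdd ha' hb'
    have h6 := mul_le_mul_of_nonneg_left h1 H.hC
    have h7 := mul_le_mul_of_nonneg_left h2 H.hC
    calc _ ≤ _ := h3
      _ ≤ 2 * 2 ^ p * (C * (K * ε) + C * (K * ε)) := by
          gcongr
          · linarith
          · linarith
      _ = _ := by ring
  have ht : Filter.Tendsto (fun ε : ℝ => (2 * 2 ^ p * (2 * (C * K))) * ε)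
      (nhdsWithin 0 (Set.Ioi 0)) (nhds 0) := by
    have : Filter.Tendsto (fun ε : ℝ => (2 * 2 ^ p * (2 * (C * K))) * ε) (nhds 0)
        (nhds ((2 * 2 ^ p * (2 * (C * K))) * 0)) := (continuous_const.mul continuous_id).tendsto 0
    rw [mul_zero] at this
    exact this.mono_left nhdsWithin_le_nhds
  refine ge_of_tendsto ht ?_
  filter_upwards [self_mem_nhdsWithin] with ε hε using key ε hε

lemma chi_coe (A : Set α) (hA : MeasurableSet A) :
    ∀ᵐ x ∂μ, chi μ A hA x = A.indicator (fun _ => (1:ℝ)) x := AEEqFun.coeFn_mk _ _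

lemma sf_coe (s : SimpleFunc α ℝ) : ∀ᵐ x ∂μ, sf μ s x = s x := AEEqFun.coeFn_mk _ _

lemma chi_bdd (A : Set α) (hA : MeasurableSet A) : ∀ᵐ x ∂μ, |chi μ A hA x| ≤ 1 := by
  filter_upwards [chi_coe (μ := μ) A hA] with x h
  rw [h]; by_cases hx : x ∈ A <;> simp [hx]

variable [IsFiniteMeasure μ]

lemma mem_chi (A : Set α) (hA : MeasurableSet A) : X.Mem (chi μ A hA) := mem_bdd (chi_bdd A hA)
lemma memPow_chi (hr : 0 < r) (A : Set α) (hA : MeasurableSet A) : X.MemPow r (chi μ A hA) :=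
  memPow_bdd hr (chi_bdd A hA)

lemma mem_sf (s : SimpleFunc α ℝ) : X.Mem (sf μ s) := (sf_bdd s).elim fun _ h => mem_bdd h.2
lemma memPow_sf (hr : 0 < r) (s : SimpleFunc α ℝ) : X.MemPow r (sf μ s) :=
  (sf_bdd s).elim fun _ h => memPow_bdd hr h.2

lemma chi_mul (A D : Set α) (hA : MeasurableSet A) (hD : MeasurableSet D) :
    chi μ A hA * chi μ D hD = chi μ _ (hA.inter hD) := by
  apply AEEqFun.ext
  filter_upwards [chi_coe (μ := μ) A hA, chi_coe (μ := μ) D hD,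
    chi_coe (μ := μ) _ (hA.inter hD), mul_coe (chi μ A hA) (chi μ D hD)] with x h1 h2 h3 h4
  rw [h4, h1, h2, h3]
  by_cases hx : x ∈ A <;> by_cases hy : x ∈ D <;> simp [hx, hy]

lemma chi_add (A D : Set α) (hA : MeasurableSet A) (hD : MeasurableSet D) :
    chi μ D hD = chi μ _ (hA.inter hD) + chi μ _ (hD.diff hA) := by
  apply AEEqFun.ext
  filter_upwards [chi_coe (μ := μ) D hD,
    chi_coe (μ := μ) _ (hA.inter hD), chi_coe (μ := μ) _ (hD.diff hA),
    add_coe (chi μ _ (hA.inter hD)) (chi μ _ (hD.diff hA))] with x h1 h2 h3 h4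
  rw [h4, h1, h2, h3]
  by_cases hx : x ∈ A <;> by_cases hy : x ∈ D <;> simp [hx, hy]

lemma chi_empty (A : Set α) (hA : MeasurableSet A) (h : A = ∅) : chi μ A hA = 0 := by
  apply AEEqFun.ext
  filter_upwards [chi_coe (μ := μ) A hA, zero_coe (μ := μ)] with x h1 h2
  rw [h1, h2]; simp [h]

lemma chi_univ : chi μ Set.univ MeasurableSet.univ = 1 := by
  apply AEEqFun.ext
  filter_upwards [chi_coe (μ := μ) Set.univ MeasurableSet.univ, one_coe (μ := μ)] with x h1 h2
  rw [h1, h2]; simp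

lemma disj (H : BH X p r C B) (A D : Set α) (hA : MeasurableSet A) (hD : MeasurableSet D)
    (h : A ∩ D = ∅) : B (chi μ A hA) (chi μ D hD) = 0 := by
  rw [H.sym, chi_empty _ _ h, H.zero₁ (memPow_chi H.hr _ _)]

lemma chi_congr {A D : Set α} (hA : MeasurableSet A) (hD : MeasurableSet D) (h : A = D) :
    chi μ A hA = chi μ D hD := by subst h; rfl

lemma s1 (H : BH X p r C B) (A D : Set α) (hA : MeasurableSet A) (hD : MeasurableSet D) :
    B (chi μ A hA) (chi μ D hD) = B (chi μ A hA * chi μ D hD) 1 := by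
  have hr := H.hr
  have hAD := hA.inter hD
  -- both sides equal B(χ_{A∩D}, χ_{A∩D})
  have e1 : B (chi μ A hA) (chi μ D hD) = B (chi μ _ hAD) (chi μ _ hAD) := by
    rw [chi_add A D hA hD, H.add₂ (mem_chi _ _) (memPow_chi hr _ _) (memPow_chi hr _ _),
      H.disj A (D \ A) hA (hD.diff hA) (by ext; simp), add_zero]
    rw [chi_add D A hD hA, chi_congr (hD.inter hA) hAD (Set.inter_comm _ _),
      H.add₁ (mem_chi _ _) (mem_chi _ _) (memPow_chi hr _ _),
      H.disj (A \ D) (A ∩ D) (hA.diff hD) hAD (by ext; simp; tauto), add_zero]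
  rw [e1, chi_mul, ← chi_univ, chi_add (A ∩ D) Set.univ hAD MeasurableSet.univ,
    H.add₂ (mem_chi _ _) (memPow_chi hr _ _) (memPow_chi hr _ _),
    H.disj (A ∩ D) (Set.univ \ (A ∩ D)) _ _ (by ext; simp), add_zero,
    chi_congr (hAD.inter MeasurableSet.univ) hAD (by simp)]

lemma sf_const (c : ℝ) {s : Set α} (hs : MeasurableSet s) :
    sf μ (SimpleFunc.piecewise s hs (SimpleFunc.const α c) (SimpleFunc.const α 0))
      = c • chi μ s hs := by
  apply AEEqFun.ext
  filter_upwards [chi_coe (μ := μ) s hs, smul_coe c (chi μ s hs), sf_coe (μ := μ)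
    (SimpleFunc.piecewise s hs (SimpleFunc.const α c) (SimpleFunc.const α 0))] with x h1 h2 h3
  rw [h3, h2, h1]
  by_cases hx : x ∈ s <;> simp [hx]

lemma sf_add (s t : SimpleFunc α ℝ) : sf μ (s + t) = sf μ s + sf μ t := by
  apply AEEqFun.ext
  filter_upwards [sf_coe (μ := μ) s, sf_coe (μ := μ) t, sf_coe (μ := μ) (s + t),
    add_coe (sf μ s) (sf μ t)] with x h1 h2 h3 h4
  rw [h4, h1, h2, h3]; rfl

lemma s1a (H : BH X p r C B) (A : Set α) (hA : MeasurableSet A) (t : SimpleFunc α ℝ) :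
    B (chi μ A hA) (sf μ t) = B (chi μ A hA * sf μ t) 1 := by
  induction t using SimpleFunc.induction with
  | const c hs =>
    rw [sf_const, H.smul₂ _ (mem_chi _ _) (memPow_chi H.hr _ _), H.s1, ae_mul_smul,
      H.smul₁ _ (mem_mul (mem_chi _ _) (chi_bdd _ _)) (memPow_one r)]
  | add _ h1 h2 =>
    rw [sf_add, H.add₂ (mem_chi _ _) (memPow_sf H.hr _) (memPow_sf H.hr _), h1, h2, ae_mul_add,
      H.add₁ _ _ (memPow_one r)]
    · rw [mul_comm]; exact mem_mul (mem_sf _) (chi_bdd _ _)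
    · rw [mul_comm]; exact mem_mul (mem_sf _) (chi_bdd _ _)

lemma s1b (H : BH X p r C B) (s t : SimpleFunc α ℝ) :
    B (sf μ s) (sf μ t) = B (sf μ s * sf μ t) 1 := by
  obtain ⟨c, -, hc⟩ := sf_bdd (μ := μ) t
  induction s using SimpleFunc.induction with
  | const c hs =>
    rw [sf_const, H.smul₁ _ (mem_chi _ _) (memPow_sf H.hr _), H.s1a, ae_smul_mul,
      H.smul₁ _ (mem_mul (mem_chi _ _) hc) (memPow_one r)]
  | add _ h1 h2 =>
    rw [sf_add, H.add₁ (mem_sf _) (mem_sf _) (memPow_sf H.hr _), h1, h2, ae_add_mul,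
      H.add₁ (mem_mul (mem_sf _) hc) (mem_mul (mem_sf _) hc) (memPow_one r)]

lemma s2 (H : BH X p r C B) {f} (hf : X.Mem f) (t : SimpleFunc α ℝ) :
    B f (sf μ t) = B (f * sf μ t) 1 := by
  obtain ⟨c, c0, hc⟩ := sf_bdd (μ := μ) t
  have n1 := NPow_nonneg (X := X) r (sf μ t)
  have n2 := NPow_nonneg (X := X) r (1 : α →ₘ[μ] ℝ)
  refine H.eq_of_small hf (memPow_sf H.hr _) (mem_mul hf hc) (memPow_one r)
    (X.NPow r (sf μ t) + c * X.NPow r (1 : α →ₘ[μ] ℝ)) fun ε hε => ?_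
  obtain ⟨s, hs, hN⟩ := H.dense f hf ε hε
  have hm := mem_sub hf hs
  refine ⟨f - sf μ s, sf μ t, (f - sf μ s) * sf μ t, 1, hm, memPow_sf H.hr _, mem_mul hm hc,
    memPow_one r, ?_, ?_, ?_⟩
  · rw [ae_sub_mul, H.sub₁ hf hs (memPow_sf H.hr _), H.sub₁ (mem_mul hf hc) (mem_mul hs hc)
      (memPow_one r), H.s1b]
    abel
  · have := mul_le_mul_of_nonneg_right hN.le n1
    have : 0 ≤ c * X.NPow r (1 : α →ₘ[μ] ℝ) * ε := by positivity
    linarith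
  · have h1 := N_mul c0 hm hc
    have h2 : X.N ((f - sf μ s) * sf μ t) ≤ c * ε := h1.trans (by gcongr)
    have h3 := mul_le_mul_of_nonneg_right h2 n2
    have : 0 ≤ X.NPow r (sf μ t) * ε := by positivity
    linarith

lemma s2' (H : BH X p r C B) {f t} (hf : X.Mem f) {c : ℝ} (hc : ∀ᵐ x ∂μ, |t x| ≤ c) :
    B f t = B (f * t) 1 := by
  have n1 := X.N_nonneg f
  have n2 := NPow_nonneg (X := X) r (1 : α →ₘ[μ] ℝ)
  refine H.eq_of_small hf (memPow_bdd H.hr hc) (mem_mul hf hc) (memPow_one r)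
    (X.N f * X.NPow r (1 : α →ₘ[μ] ℝ)) fun ε hε => ?_
  obtain ⟨s, hs⟩ := exists_sf hc hε
  obtain ⟨d, d0, hd⟩ := sf_bdd (μ := μ) s
  refine ⟨f, t - sf μ s, f * (t - sf μ s), 1, hf, memPow_bdd H.hr hs, mem_mul hf hs,
    memPow_one r, ?_, ?_, ?_⟩
  · rw [ae_mul_sub, H.sub₂ hf (memPow_bdd H.hr hc) (memPow_sf H.hr _),
      H.sub₁ (mem_mul hf hc) (mem_mul hf hd) (memPow_one r), H.s2 hf]
    abel
  · have := mul_le_mul_of_nonneg_left (NPow_bdd (X := X) H.hr hε.le hs) n1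
    linarith
  · have := mul_le_mul_of_nonneg_right (N_mul hε.le hf hs) n2
    linarith

lemma s3 (H : BH X p r C B) {f g t} (hf : X.Mem f) (hg : X.MemPow r g)
    (hc : ∀ᵐ x ∂μ, |t x| ≤ 1) : B (f * t) g = B f (g * t) := by
  have n1 := X.N_nonneg f
  refine H.eq_of_small (mem_mul hf hc) hg hf (memPow_mul H.hr hg hc) (X.N f) fun ε hε => ?_
  obtain ⟨k, d, hd, hk, hN⟩ := exists_trunc H.oc H.hr hg hε
  have hm := memPow_sub H.hr hg hk
  refine ⟨f * t, g - k, f, (g - k) * t, mem_mul hf hc, hm, hf, memPow_mul H.hr hm hc, ?_, ?_, ?_⟩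
  · have hkt : ∀ᵐ x ∂μ, |(k * t) x| ≤ d := by
      filter_upwards [hd, hc, mul_coe k t] with x h1 h2 h3
      rw [h3, abs_mul]
      nlinarith [abs_nonneg (k x), abs_nonneg (t x)]
    have e : B (f * t) k = B f (k * t) := by
      rw [H.s2' (mem_mul hf hc) hd, H.s2' hf hkt, mul_assoc, mul_comm t k]
    rw [ae_sub_mul, H.sub₂ (mem_mul hf hc) hg hk, H.sub₂ hf (memPow_mul H.hr hg hc)
      (memPow_mul H.hr hk hc), e]
    abel
  · have h1 := N_mul zero_le_one hf hc
    rw [one_mul] at h1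
    exact mul_le_mul h1 hN.le (NPow_nonneg _ _) n1
  · have h1 := NPow_mul H.hr zero_le_one hm hc
    rw [one_mul] at h1
    exact mul_le_mul_of_nonneg_left (h1.trans hN.le) n1

lemma key (H : BH X p r C B) {f g f' g'} (hf : X.Mem f) (hg : X.MemPow r g)
    (hf' : X.Mem f') (hg' : X.MemPow r g') (h : f * g = f' * g') : B f g = B f' g' := by
  let u : α →ₘ[μ] ℝ := AEEqFun.mk (fun x => |g x| + |g' x|)
    (AEMeasurable.aestronglyMeasurable
      ((g.measurable.abs).add (g'.measurable.abs)).aemeasurable)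
  let t : α →ₘ[μ] ℝ := AEEqFun.mk (fun x => g x / (|g x| + |g' x|))
    (AEMeasurable.aestronglyMeasurable
      (g.measurable.div ((g.measurable.abs).add (g'.measurable.abs))).aemeasurable)
  let t' : α →ₘ[μ] ℝ := AEEqFun.mk (fun x => g' x / (|g x| + |g' x|))
    (AEMeasurable.aestronglyMeasurable
      (g'.measurable.div ((g.measurable.abs).add (g'.measurable.abs))).aemeasurable)
  have cu : ∀ᵐ x ∂μ, u x = |g x| + |g' x| := AEEqFun.coeFn_mk _ _
  have ct : ∀ᵐ x ∂μ, t x = g x / (|g x| + |g' x|) := AEEqFun.coeFn_mk _ _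
  have ct' : ∀ᵐ x ∂μ, t' x = g' x / (|g x| + |g' x|) := AEEqFun.coeFn_mk _ _
  have hu : X.MemPow r u := by
    have a : ∀ {k : α →ₘ[μ] ℝ}, X.MemPow r k → X.MemPow r |k| := fun {k} hk =>
      memPow_ae H.hr hk (by
        filter_upwards [AEEqFun.coeFn_abs k] with x h
        rw [h, abs_abs])
    refine memPow_ae H.hr (memPow_add H.hr (a hg) (a hg')) ?_
    filter_upwards [cu, add_coe |g| |g'|, AEEqFun.coeFn_abs g, AEEqFun.coeFn_abs g']
      with x h1 h2 h3 h4
    rw [h1, h2, h3, h4]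
  have ht : ∀ᵐ x ∂μ, |t x| ≤ 1 := by
    filter_upwards [ct] with x h1
    rw [h1, abs_div, abs_of_nonneg (a := |g x| + |g' x|) (by positivity)]
    exact div_le_one_of_le₀ (by linarith [abs_nonneg (g' x)]) (by positivity)
  have ht' : ∀ᵐ x ∂μ, |t' x| ≤ 1 := by
    filter_upwards [ct'] with x h1
    rw [h1, abs_div, abs_of_nonneg (a := |g x| + |g' x|) (by positivity)]
    exact div_le_one_of_le₀ (by linarith [abs_nonneg (g x)]) (by positivity)
  have e1 : g = u * t := by
    apply AEEqFun.ext
    filter_upwards [cu, ct, mul_coe u t] with x h1 h2 h3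
    rw [h3, h1, h2]
    by_cases h0 : |g x| + |g' x| = 0
    · have : |g x| = 0 := by linarith [abs_nonneg (g x), abs_nonneg (g' x)]
      simp [abs_eq_zero.1 this]
    · field_simp
  have e2 : g' = u * t' := by
    apply AEEqFun.ext
    filter_upwards [cu, ct', mul_coe u t'] with x h1 h2 h3
    rw [h3, h1, h2]
    by_cases h0 : |g x| + |g' x| = 0
    · have : |g' x| = 0 := by linarith [abs_nonneg (g x), abs_nonneg (g' x)]
      simp [abs_eq_zero.1 this]
    · field_simp
  have e3 : f * t = f' * t' := by
    apply AEEqFun.ext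
    have hh := mul_coe f g
    rw [h] at hh
    filter_upwards [ct, ct', mul_coe f t, mul_coe f' t', hh, mul_coe f' g']
      with x h1 h2 h3 h4 h5 h6
    rw [h3, h4, h1, h2, mul_div_assoc', mul_div_assoc', ← h5, h6]
  calc B f g = B f (u * t) := by rw [← e1]
    _ = B (f * t) u := (H.s3 hf hu ht).symm
    _ = B (f' * t') u := by rw [e3]
    _ = B f' (u * t') := H.s3 hf' hu ht'
    _ = B f' g' := by rw [← e2]

end BH

lemma spw_bdd_ae (s : ℝ) (h : α →ₘ[μ] ℝ) : ∀ᵐ x ∂μ, |spw s h x| ≤ |pw s h x| := by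
  filter_upwards [spw_coe s h, pw_coe s h] with x h1 h2
  rw [h1, h2, abs_mul]
  have : |Real.sign (h x)| ≤ 1 := by
    rcases Real.sign_apply_eq (h x) with h | h | h <;> rw [h] <;> simp
  nlinarith [abs_nonneg (|h x| ^ s)]

lemma pw_pw (s t : ℝ) (h : α →ₘ[μ] ℝ) : pw s (pw t h) = pw (t * s) h := by
  apply AEEqFun.ext
  filter_upwards [pw_coe s (pw t h), pw_coe t h, pw_coe (t * s) h] with x h1 h2 h3
  rw [h1, h2, h3, abs_of_nonneg (a := |h x| ^ t) (by positivity), Real.rpow_mul (abs_nonneg _)]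

lemma spw_mul_pw {s t : ℝ} (hst : s + t = 1) (h : α →ₘ[μ] ℝ) : spw s h * pw t h = h := by
  apply AEEqFun.ext
  filter_upwards [spw_coe s h, pw_coe t h, mul_coe (spw s h) (pw t h)] with x h1 h2 h3
  rw [h3, h1, h2]
  rcases lt_trichotomy (h x) 0 with h0 | h0 | h0
  · rw [mul_assoc, ← Real.rpow_add (abs_pos.2 h0.ne), hst, Real.rpow_one, Real.sign_of_neg h0,
      abs_of_neg h0]; ring
  · simp [h0]
  · rw [mul_assoc, ← Real.rpow_add (abs_pos.2 h0.ne'), hst, Real.rpow_one, Real.sign_of_pos h0,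
      abs_of_pos h0]; ring

namespace BH

variable {p r C : ℝ} {B : (α →ₘ[μ] ℝ) → (α →ₘ[μ] ℝ) → (α →ₘ[μ] ℝ)}

lemma mem_prod (H : BH X p r C B) {f g} (hf : X.Mem f) (hg : X.MemPow r g) :
    X.MemPow p (f * g) := by
  have hr := H.hr
  have hp0 := H.hp0
  have af : X.Mem |f| := mem_ae hf (by
    filter_upwards [AEEqFun.coeFn_abs f] with x h
    rw [h, abs_abs])
  refine mem_ae (X.mem_add af hg) ?_
  filter_upwards [AEEqFun.coeFn_abs f, pw_coe r⁻¹ g, add_coe |f| (pw r⁻¹ g), pw_coe p⁻¹ (f * g),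
    mul_coe f g] with x h1 h2 h3 h4 h5
  rw [h4, h5, h3, h1, h2, abs_mul]
  set a := |f x|
  set b := |g x| ^ r⁻¹ with hb
  have ha0 : 0 ≤ a := abs_nonneg _
  have hb0 : 0 ≤ b := by positivity
  have hgb : |g x| = b ^ r := by
    rw [hb, ← Real.rpow_mul (abs_nonneg _), inv_mul_cancel₀ hr.ne', Real.rpow_one]
  rw [abs_of_nonneg (a := a + b) (by positivity), hgb, abs_of_nonneg (by positivity)]
  calc (a * b ^ r) ^ p⁻¹ ≤ ((a + b) * (a + b) ^ r) ^ p⁻¹ := by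
        gcongr <;> linarith
    _ = ((a + b) ^ p) ^ p⁻¹ := by
        rw [H.hp, Real.rpow_add_of_nonneg (by positivity) zero_le_one hr.le, Real.rpow_one]
    _ = a + b := by
        rw [← Real.rpow_mul (by positivity), mul_inv_cancel₀ hp0.ne', Real.rpow_one]

lemma sum1 (H : BH X p r C B) : p⁻¹ + r / p = 1 := by
  have := H.hp0
  have := H.hp
  field_simp
  linarith

lemma memS {h : α →ₘ[μ] ℝ} (hh : X.MemPow p h) : X.Mem (spw p⁻¹ h) :=
  mem_ae hh (spw_bdd_ae _ _)

lemma pwW (H : BH X p r C B) (h : α →ₘ[μ] ℝ) : pw r⁻¹ (pw (r / p) h) = pw p⁻¹ h := by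
  have := H.hp0
  have := H.hr
  rw [pw_pw]; congr 1; field_simp

lemma memW (H : BH X p r C B) {h : α →ₘ[μ] ℝ} (hh : X.MemPow p h) : X.MemPow r (pw (r / p) h) := by
  unfold MemPow; rw [H.pwW]; exact hh

lemma main [IsFiniteMeasure μ] (H : BH X p r C B) :
    ∃ T : (α →ₘ[μ] ℝ) → (α →ₘ[μ] ℝ), X.IsBoundedOpPow p T ∧
        ∀ f g, X.Mem f → X.MemPow r g → B f g = T (f * g) := by
  have hp0 := H.hp0
  have hr := H.hr
  have hT : ∀ f g h, X.Mem f → X.MemPow r g → X.MemPow p h → f * g = h →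
      B f g = B (spw p⁻¹ h) (pw (r / p) h) := fun f g h hf hg hh he =>
    H.key hf hg (memS hh) (H.memW hh) (by rw [he, spw_mul_pw H.sum1])
  refine ⟨fun h => B (spw p⁻¹ h) (pw (r / p) h), ⟨?_, ?_, ?_, C, ?_⟩, ?_⟩
  · intro h hh
    exact H.mem (memS hh) (H.memW hh)
  · intro h k hh hk
    let m : α →ₘ[μ] ℝ := AEEqFun.mk (fun x => |h x| + |k x|)
      (AEMeasurable.aestronglyMeasurable
        ((h.measurable.abs).add (k.measurable.abs)).aemeasurable)
    have cm : ∀ᵐ x ∂μ, m x = |h x| + |k x| := AEEqFun.coeFn_mk _ _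
    have hm : X.MemPow p m := by
      have a : ∀ {k : α →ₘ[μ] ℝ}, X.MemPow p k → X.MemPow p |k| := fun {k} hk =>
        memPow_ae hp0 hk (by
          filter_upwards [AEEqFun.coeFn_abs k] with x h
          rw [h, abs_abs])
      refine memPow_ae hp0 (memPow_add hp0 (a hh) (a hk)) ?_
      filter_upwards [cm, add_coe |h| |k|, AEEqFun.coeFn_abs h, AEEqFun.coeFn_abs k]
        with x h1 h2 h3 h4
      rw [h1, h2, h3, h4]
    have fac : ∀ w : α →ₘ[μ] ℝ, (∀ᵐ x ∂μ, |w x| ≤ m x) →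
        ∃ a, X.Mem a ∧ a * pw (r / p) m = w := by
      intro w hw
      let t : α →ₘ[μ] ℝ := AEEqFun.mk (fun x => w x / m x)
        (AEMeasurable.aestronglyMeasurable (w.measurable.div m.measurable).aemeasurable)
      have ct : ∀ᵐ x ∂μ, t x = w x / m x := AEEqFun.coeFn_mk _ _
      have ht : ∀ᵐ x ∂μ, |t x| ≤ 1 := by
        filter_upwards [ct, hw] with x h1 h2
        have h3 : 0 ≤ m x := (abs_nonneg _).trans h2
        rw [h1, abs_div, abs_of_nonneg h3]
        exact div_le_one_of_le₀ h2 h3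
      refine ⟨spw p⁻¹ m * t, mem_mul (memS hm) ht, ?_⟩
      rw [mul_assoc, mul_comm t, ← mul_assoc, spw_mul_pw H.sum1]
      apply AEEqFun.ext
      filter_upwards [ct, hw, mul_coe m t] with x h1 h2 h3
      rw [h3, h1]
      by_cases h0 : m x = 0
      · rw [h0] at h2
        simp [abs_eq_zero.1 (le_antisymm h2 (abs_nonneg _))]
      · field_simp
    obtain ⟨a, ha, ea⟩ := fac h (by
      filter_upwards [cm] with x h1
      rw [h1]; linarith [abs_nonneg (k x)])
    obtain ⟨b, hb, eb⟩ := fac k (by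
      filter_upwards [cm] with x h1
      rw [h1]; linarith [abs_nonneg (h x)])
    have hu := H.memW hm
    show B _ _ = B _ _ + B _ _
    rw [← hT a _ h ha hu hh ea, ← hT b _ k hb hu hk eb, ← H.add₁ ha hb hu]
    exact (hT _ _ _ (X.mem_add ha hb) hu (memPow_add hp0 hh hk) (by rw [ae_add_mul, ea, eb])).symm
  · intro c h hh
    show B _ _ = c • B _ _
    rw [← H.smul₁ c (memS hh) (H.memW hh)]
    exact (hT _ _ _ (X.mem_smul c (memS hh)) (H.memW hh) (memPow_smul c hh)
      (by rw [ae_smul_mul, spw_mul_pw H.sum1])).symm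
  · intro h hh
    refine (H.bdd (memS hh) (H.memW hh)).trans ?_
    have h1 := N_ae hh (spw_bdd_ae p⁻¹ h)
    have hC := H.hC
    unfold NPow
    rw [H.pwW]
    have n := X.N_nonneg (pw p⁻¹ h)
    calc _ ≤ C * X.N (pw p⁻¹ h) * X.N (pw p⁻¹ h) ^ r := by gcongr
      _ = C * X.N (pw p⁻¹ h) ^ (1 + r) := by
        rw [Real.rpow_add_of_nonneg n zero_le_one hr.le, Real.rpow_one, mul_assoc]
      _ = _ := by rw [← H.hp]
  · intro f g hf hg
    exact hT f g _ hf hg (H.mem_prod hf hg) rfl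

end BH

lemma memPow_chi' [IsFiniteMeasure μ] {r : ℝ} (hr : 0 ≤ r) (A : Set α) (hA : MeasurableSet A) :
    X.MemPow r (chi μ A hA) := by
  refine mem_bdd (c := 1) ?_
  filter_upwards [pw_coe r⁻¹ (chi μ A hA), BH.chi_bdd (μ := μ) A hA] with x h1 h2
  rw [h1, abs_of_nonneg (by positivity)]
  exact Real.rpow_le_one (abs_nonneg _) h2 (by positivity)

lemma pw_zero (g : α →ₘ[μ] ℝ) : pw 0 g = 1 := by
  apply AEEqFun.ext
  filter_upwards [pw_coe 0 g, one_coe (μ := μ)] with x h1 h2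
  rw [h1, h2, Real.rpow_zero]

end BanachFunctionSpace

open BanachFunctionSpace in
/-- for an order continuous constant-1 `p`-convex Banach function
space `X` over a finite measure in which simple functions are dense, a
continuous bilinear map `B : X × X_{[p/p']} → X_{[p]}` is symmetric
(`B(χ_A, χ_C) = B(χ_{A∩C}, χ_{A∪C})`) iff `B(f,g) = T(f·g)` for some bounded
operator `T` on `X_{[p]}`. -/
theorem symmetric_bilinear_iff_factors_through_product
    {α : Type*} [MeasurableSpace α] {μ : Measure α} [IsFiniteMeasure μ]
    (X : BanachFunctionSpace α μ)
    (p p' : ℝ) (hp : 1 ≤ p) (hpp' : 1 / p + 1 / p' = 1)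
    (hconv : X.PConvex1 p) (hoc : X.OrderCont)
    (hdense : ∀ f, X.Mem f → ∀ ε > (0 : ℝ), ∃ s : SimpleFunc α ℝ,
      X.Mem (AEEqFun.mk s s.aestronglyMeasurable) ∧
        X.N (f - AEEqFun.mk s s.aestronglyMeasurable) < ε)
    (B : (α →ₘ[μ] ℝ) → (α →ₘ[μ] ℝ) → (α →ₘ[μ] ℝ))
    (hBmem : ∀ f g, X.Mem f → X.MemPow (p / p') g → X.MemPow p (B f g))
    (hBadd₁ : ∀ f₁ f₂ g, X.Mem f₁ → X.Mem f₂ → X.MemPow (p / p') g →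
      B (f₁ + f₂) g = B f₁ g + B f₂ g)
    (hBadd₂ : ∀ f g₁ g₂, X.Mem f → X.MemPow (p / p') g₁ → X.MemPow (p / p') g₂ →
      B f (g₁ + g₂) = B f g₁ + B f g₂)
    (hBsmul₁ : ∀ (c : ℝ) f g, X.Mem f → X.MemPow (p / p') g →
      B (c • f) g = c • B f g)
    (hBsmul₂ : ∀ (c : ℝ) f g, X.Mem f → X.MemPow (p / p') g →
      B f (c • g) = c • B f g)
    (hBbdd : ∃ C : ℝ, ∀ f g, X.Mem f → X.MemPow (p / p') g →
      X.NPow p (B f g) ≤ C * X.N f * X.NPow (p / p') g) :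
    (∀ (A C : Set α) (hA : MeasurableSet A) (hC : MeasurableSet C),
        B (AEEqFun.mk (A.indicator fun _ => (1 : ℝ))
            ((measurable_const.indicator hA).aestronglyMeasurable))
          (AEEqFun.mk (C.indicator fun _ => (1 : ℝ))
            ((measurable_const.indicator hC).aestronglyMeasurable)) =
        B (AEEqFun.mk ((A ∩ C).indicator fun _ => (1 : ℝ))
            ((measurable_const.indicator (hA.inter hC)).aestronglyMeasurable))
          (AEEqFun.mk ((A ∪ C).indicator fun _ => (1 : ℝ))
            ((measurable_const.indicator (hA.union hC)).aestronglyMeasurable))) ↔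
      ∃ T : (α →ₘ[μ] ℝ) → (α →ₘ[μ] ℝ), X.IsBoundedOpPow p T ∧
        ∀ f g, X.Mem f → X.MemPow (p / p') g → B f g = T (f * g) := by

  have hp0 : 0 < p := by linarith
  have hr0 : p / p' = p - 1 := by
    have h1 : 1 / p' = 1 - 1 / p := by linarith
    rw [div_eq_mul_one_div, h1]
    field_simp
  constructor
  · intro hsym
    obtain ⟨C, hC⟩ := hBbdd
    rcases hp.eq_or_lt with h1 | h1
    · -- degenerate case `p = 1`
      have hz : p / p' = 0 := by rw [hr0, ← h1, sub_self]
      rw [hz] at hBmem hC hBsmul₂ ⊢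
      have hmem : ∀ g, X.MemPow 0 g := fun g => by
        unfold MemPow; rw [inv_zero, pw_zero]; exact mem_one
      have hB0 : ∀ f g, X.Mem f → B f g = 0 := by
        intro f g hf
        apply eq_zero_of_NPow hp0 (hBmem f g hf (hmem g))
        by_contra hne
        have hpos : 0 < X.NPow p (B f g) := lt_of_le_of_ne (NPow_nonneg _ _) (Ne.symm hne)
        have hb : ∀ c : ℝ, |c| * X.NPow p (B f g) ≤ C * X.N f := by
          intro c
          have h2 := hC f (c • g) hf (hmem _)
          rw [hBsmul₂ c f g hf (hmem g), NPow_smul hp0] at h2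
          have h4 : X.NPow 0 (c • g) = 1 := Real.rpow_zero _
          rwa [h4, mul_one] at h2
        have h3 := hb ((|C * X.N f| + 1) / X.NPow p (B f g))
        rw [abs_of_nonneg (by positivity), div_mul_cancel₀ _ hne] at h3
        linarith [le_abs_self (C * X.N f)]
      refine ⟨fun _ => 0, ⟨?_, ?_, ?_, 0, ?_⟩, fun f g hf _ => hB0 f g hf⟩
      · intro h _
        have := hBmem 0 0 X.mem_zero (hmem 0)
        rwa [hB0 0 0 X.mem_zero] at this
      · intros; simp
      · intros; simp
      · intro h _
        have h2 := NPow_smul (X := X) hp0 0 0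
        rw [zero_smul, abs_zero, zero_mul] at h2
        rw [h2, zero_mul]
    · have H : BH X p (p / p') (max C 0) B :=
        { hr := by rw [hr0]; linarith
          hp := by rw [hr0]; ring
          hC := le_max_right _ _
          mem := fun {f g} => hBmem f g
          add₁ := fun {f₁ f₂ g} => hBadd₁ f₁ f₂ g
          add₂ := fun {f g₁ g₂} => hBadd₂ f g₁ g₂
          smul₁ := fun c {f g} => hBsmul₁ c f g
          smul₂ := fun c {f g} => hBsmul₂ c f g
          bdd := fun {f g} hf hg => (hC f g hf hg).trans (by
            have := X.N_nonneg f
            have := NPow_nonneg (X := X) (p / p') g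
            gcongr
            exact le_max_left _ _)
          oc := hoc
          dense := hdense
          sym := hsym }
      exact H.main
  · rintro ⟨T, -, hT⟩ A D hA hD
    have hr : 0 ≤ p / p' := by rw [hr0]; linarith
    rw [hT _ _ (BH.mem_chi A hA) (memPow_chi' hr D hD),
      hT _ _ (BH.mem_chi _ (hA.inter hD)) (memPow_chi' hr _ (hA.union hD)),
      BH.chi_mul, BH.chi_mul]
    congr 1
    exact BH.chi_congr _ _ (by ext x; simp; tauto)
end
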